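/- Let φ₊ = (|00⟩ + |11⟩)/√2 ∈ ℂ² ⊗ ℂ² and for p ∈ [0,1] let ρ_p = p·|φ₊⟩⟨φ₊| + (1−p)·I₄/4, where I₄ is the identity on ℂ² ⊗ ℂ² (indexed by Fin 2 × Fin 2). Then ρ_p is a density matrix for every p ∈ [0,1], and ρ_p is separable if and only if p ≤ 1/3; in particular ρ_p is entangled for every p > 1/3. -/

import Mathlib

open Matrix
open scoped Kronecker ComplexOrder

/-- A density matrix: a Hermitian positive semidefinite complex matrix of trace `1`. -/
def IsDensityMatrix {ι : Type*} [Fintype ι] [DecidableEq ι] (ρ : Matrix ι ι ℂ) : Prop :=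
  ρ.PosSemidef ∧ ρ.trace = 1

open scoped Classical in
/-- The eigenvalues (counted with multiplicity) of a Hermitian complex matrix,
as a real-valued family; junk value `0` on non-Hermitian matrices. -/
noncomputable def eigs {ι : Type*} [Fintype ι] [DecidableEq ι] (ρ : Matrix ι ι ℂ) : ι → ℝ :=
  if h : ρ.IsHermitian then h.eigenvalues else 0

/-- The von Neumann entropy `S(ρ) = -∑ᵢ λᵢ log λᵢ` of a Hermitian matrix, where `(λᵢ)` are the
eigenvalues counted with multiplicity (note `Real.log 0 = 0`, so `0 * log 0 = 0`). -/
noncomputable def vnEntropy {ι : Type*} [Fintype ι] [DecidableEq ι] (ρ : Matrix ι ι ℂ) : ℝ :=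
  -∑ i, eigs ρ i * Real.log (eigs ρ i)

/-- The partial trace over the second tensor factor: `(Tr₂ ρ)(i,j) = ∑ₖ ρ((i,k),(j,k))`. -/
noncomputable def ptrace2 {n m : ℕ} (ρ : Matrix (Fin n × Fin m) (Fin n × Fin m) ℂ) :
    Matrix (Fin n) (Fin n) ℂ :=
  Matrix.of fun i j => ∑ k, ρ (i, k) (j, k)

/-- The partial trace over the first tensor factor: `(Tr₁ ρ)(i,j) = ∑ₖ ρ((k,i),(k,j))`. -/
noncomputable def ptrace1 {n m : ℕ} (ρ : Matrix (Fin n × Fin m) (Fin n × Fin m) ℂ) :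
    Matrix (Fin m) (Fin m) ℂ :=
  Matrix.of fun i j => ∑ k, ρ (k, i) (k, j)

/-- A density matrix on `ℂⁿ ⊗ ℂᵐ` is separable if it is a finite convex combination of Kronecker
products of density matrices on the factors; otherwise it is entangled. -/
def IsSeparableState {n m : ℕ} (ρ : Matrix (Fin n × Fin m) (Fin n × Fin m) ℂ) : Prop :=
  ∃ (N : ℕ) (p : Fin N → ℝ) (σ : Fin N → Matrix (Fin n) (Fin n) ℂ)
    (τ : Fin N → Matrix (Fin m) (Fin m) ℂ),
    (∀ i, 0 ≤ p i) ∧ (∑ i, p i = 1) ∧ (∀ i, IsDensityMatrix (σ i)) ∧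
    (∀ i, IsDensityMatrix (τ i)) ∧ ρ = ∑ i, (p i : ℂ) • (σ i ⊗ₖ τ i)

/-- The Bell state `φ₊ = (|00⟩ + |11⟩)/√2 ∈ ℂ² ⊗ ℂ²`. -/
noncomputable def phiPlus : Fin 2 × Fin 2 → ℂ :=
  fun x => if x.1 = x.2 then ((Real.sqrt 2 : ℝ) : ℂ)⁻¹ else 0

/-- The Werner-type state `ρ_p = p·|φ₊⟩⟨φ₊| + (1−p)·I₄/4`. -/
noncomputable def rhoP (p : ℝ) : Matrix (Fin 2 × Fin 2) (Fin 2 × Fin 2) ℂ :=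
  (p : ℂ) • Matrix.vecMulVec phiPlus (star phiPlus) +
    (((1 - p : ℝ) : ℂ) / 4) • (1 : Matrix (Fin 2 × Fin 2) (Fin 2 × Fin 2) ℂ)

/-- The qubit state with Bloch vector `(x, y, z)`. -/
noncomputable def blochState (x y z : ℝ) : Matrix (Fin 2) (Fin 2) ℂ :=
  !![(1 + z) / 2, (x - y * Complex.I) / 2; (x + y * Complex.I) / 2, (1 - z) / 2]

lemma isHermitian_blochState (x y z : ℝ) : (blochState x y z).IsHermitian := by
  ext i j
  fin_cases i <;> fin_cases j <;> simp [blochState, sub_eq_add_neg]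

lemma isDensityMatrix_blochState {x y z : ℝ} (h : x ^ 2 + y ^ 2 + z ^ 2 ≤ 1) :
    IsDensityMatrix (blochState x y z) := by
  refine ⟨?_, by simp [blochState, Matrix.trace_fin_two]; ring⟩
  have key : blochState x y z = (blochState x y z)ᴴ * blochState x y z +
      (((1 - (x ^ 2 + y ^ 2 + z ^ 2)) / 4 : ℝ) : ℂ) • (1 : Matrix (Fin 2) (Fin 2) ℂ) := by
    rw [(isHermitian_blochState x y z).eq]
    ext i j
    fin_cases i <;> fin_cases j <;>
      simp [blochState] <;> ring_nf <;> simp [Complex.I_sq]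
  rw [key]
  refine (posSemidef_conjTranspose_mul_self _).add (PosSemidef.one.smul ?_)
  exact Complex.zero_le_real.2 (by linarith)

lemma inv_sqrt_two_mul_self : ((Real.sqrt 2 : ℝ) : ℂ)⁻¹ * ((Real.sqrt 2 : ℝ) : ℂ)⁻¹ = 1 / 2 := by
  rw [← mul_inv, ← Complex.ofReal_mul, Real.mul_self_sqrt (by norm_num)]
  norm_num

lemma isDensityMatrix_rhoP {p : ℝ} (h0 : 0 ≤ p) (h1 : p ≤ 1) : IsDensityMatrix (rhoP p) := by
  constructor
  · refine ((posSemidef_vecMulVec_self_star phiPlus).smul (Complex.zero_le_real.2 h0)).add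
      (PosSemidef.one.smul ?_)
    have : (0 : ℂ) ≤ (((1 - p) / 4 : ℝ) : ℂ) := Complex.zero_le_real.2 (by linarith)
    simpa using this
  · simp [rhoP, Matrix.trace, Fintype.sum_prod_type, vecMulVec_apply, phiPlus,
      inv_sqrt_two_mul_self]
    ring

/-- The Peres criterion evaluated at the vector `|01⟩ - |10⟩`. -/
lemma IsSeparableState.partial_transpose_nonneg {ρ : Matrix (Fin 2 × Fin 2) (Fin 2 × Fin 2) ℂ}
    (h : IsSeparableState ρ) :
    0 ≤ ρ (0, 1) (0, 1) + ρ (1, 0) (1, 0) - ρ (0, 0) (1, 1) - ρ (1, 1) (0, 0) := by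
  obtain ⟨N, q, σ, τ, hq, -, hσ, hτ, rfl⟩ := h
  simp only [Matrix.sum_apply, ← Finset.sum_add_distrib, ← Finset.sum_sub_distrib]
  refine Finset.sum_nonneg fun i _ => ?_
  have hpsd := ((hσ i).1.kronecker (hτ i).1.transpose).dotProduct_mulVec_nonneg
    (fun x : Fin 2 × Fin 2 => if x = (0, 1) then 1 else if x = (1, 0) then -1 else 0)
  have := mul_nonneg (Complex.zero_le_real.2 (hq i)) hpsd
  convert this using 1
  simp [dotProduct, mulVec, Fintype.sum_prod_type, kroneckerMap_apply]
  ring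

lemma isSeparableState_rhoP {p : ℝ} (h0 : 0 ≤ p) (h1 : p ≤ 1 / 3) :
    IsSeparableState (rhoP p) := by
  let x : Fin 6 → ℝ := ![1, -1, 0, 0, 0, 0]
  let y : Fin 6 → ℝ := ![0, 0, 1, -1, 0, 0]
  let z : Fin 6 → ℝ := ![0, 0, 0, 0, 1, -1]
  have hunit (i : Fin 6) : x i ^ 2 + y i ^ 2 + z i ^ 2 = 1 := by
    fin_cases i <;> simp [x, y, z]
  refine ⟨6, fun _ => 1 / 6, fun i => blochState (3 * p * x i) (3 * p * y i) (3 * p * z i),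
    fun i => blochState (x i) (-y i) (z i), fun _ => by norm_num, by norm_num,
    fun i => isDensityMatrix_blochState ?_, fun i => isDensityMatrix_blochState ?_, ?_⟩
  · calc _ = (3 * p) ^ 2 * (x i ^ 2 + y i ^ 2 + z i ^ 2) := by ring
      _ ≤ 1 := by rw [hunit]; nlinarith
  · rw [neg_sq, hunit]
  · ext ⟨i, j⟩ ⟨k, l⟩
    simp only [Fin.sum_univ_six]
    fin_cases i <;> fin_cases j <;> fin_cases k <;> fin_cases l <;>
      simp [rhoP, blochState, vecMulVec_apply, phiPlus, inv_sqrt_two_mul_self, x, y, z] <;>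
      ring_nf <;> simp [Complex.I_sq] <;> ring

/-- For every `p ∈ [0,1]`, `ρ_p = p·|φ₊⟩⟨φ₊| + (1−p)·I₄/4` is a density
matrix, and `ρ_p` is separable if and only if `p ≤ 1/3`; in particular `ρ_p` is entangled for
every `p > 1/3`. -/
theorem werner_state_separability :
    ∀ p ∈ Set.Icc (0 : ℝ) 1,
      IsDensityMatrix (rhoP p) ∧ (IsSeparableState (rhoP p) ↔ p ≤ 1 / 3) := by
  rintro p ⟨h0, h1⟩
  refine ⟨isDensityMatrix_rhoP h0 h1, fun h => ?_, isSeparableState_rhoP h0⟩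
  have hnonneg := h.partial_transpose_nonneg
  have heq : rhoP p (0, 1) (0, 1) + rhoP p (1, 0) (1, 0) - rhoP p (0, 0) (1, 1) -
      rhoP p (1, 1) (0, 0) = (((1 - 3 * p) / 2 : ℝ) : ℂ) := by
    simp [rhoP, vecMulVec_apply, phiPlus, inv_sqrt_two_mul_self]
    ring
  rw [heq, Complex.zero_le_real] at hnonneg
  linarith
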